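/- For every finite simple graph G, the inequality χ̃_qa(G) ≤ χ̃_q(G) holds. In particular, if A ∈ cl(CS+^{nt}) satisfies A ∈ A^t and L_{G,t}(A) = 0, then the block matrix R = [[A, A], [A, A]] belongs to cl(CS+^{2nt}) ∩ B^t and satisfies 𝓛_{G,t}(π(R)) = 0. -/

import Mathlib

open Matrix

/-- The completely positive semidefinite cone, for matrices indexed by a finite type. -/
def IsCSPlus {ι : Type} [Fintype ι] (A : Matrix ι ι ℝ) : Prop :=
  ∃ d : ℕ, 1 ≤ d ∧ ∃ X : ι → Matrix (Fin d) (Fin d) ℝ,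
    (∀ i, (X i).PosSemidef) ∧ ∀ i j, A i j = (X i * X j).trace

/-- The linear functional `L_{G,t}`. -/
noncomputable def LG {V : Type} [Fintype V] (G : SimpleGraph V) [DecidableRel G.Adj] (t : ℕ)
    (A : Matrix (V × Fin t) (V × Fin t) ℝ) : ℝ :=
  (∑ u : V, ∑ i : Fin t, ∑ j : Fin t, if i ≠ j then A (u, i) (u, j) else 0) +
    (1 / 2) * ∑ u : V, ∑ v : V,
      if G.Adj u v then ∑ i : Fin t, A (u, i) (v, i) else 0

/-- Feasibility of `t` in the program defining `χ̃_q(G)`. -/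
def chiqFeas {V : Type} [Fintype V] (G : SimpleGraph V) [DecidableRel G.Adj] (t : ℕ) : Prop :=
  ∃ A : Matrix (V × Fin t) (V × Fin t) ℝ, A.IsSymm ∧
    A ∈ closure {B : Matrix (V × Fin t) (V × Fin t) ℝ | IsCSPlus B} ∧
    (∀ u v : V, (∑ i : Fin t, ∑ j : Fin t, A (u, i) (v, j)) = 1) ∧
    LG G t A = 0

/-- The parameter `χ̃_q(G)`. -/
noncomputable def chiqTilde {V : Type} [Fintype V] (G : SimpleGraph V)
    [DecidableRel G.Adj] : ℕ :=
  sInf {t : ℕ | chiqFeas G t}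

/-- The projection `π(R)`: `P(i,j|u,v) = R_{(1,u,i),(2,v,j)}`. -/
def piMap {V : Type} (t : ℕ)
    (R : Matrix ((V × Fin t) ⊕ (V × Fin t)) ((V × Fin t) ⊕ (V × Fin t)) ℝ) :
    Fin t → Fin t → V → V → ℝ :=
  fun i j u v => R (Sum.inl (u, i)) (Sum.inr (v, j))

/-- The functional `𝓛_{G,t}` on arrays `P(i,j|u,v)`. -/
noncomputable def calL {V : Type} [Fintype V] (G : SimpleGraph V) [DecidableRel G.Adj] (t : ℕ)
    (P : Fin t → Fin t → V → V → ℝ) : ℝ :=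
  (∑ u : V, ∑ i : Fin t, ∑ j : Fin t, if i ≠ j then P i j u u else 0) +
    (1 / 2) * ∑ u : V, ∑ v : V, if G.Adj u v then ∑ i : Fin t, P i i u v else 0

/-- Membership of `R` in the affine space `B^t`. -/
def InBt {V : Type} [Fintype V] (t : ℕ)
    (R : Matrix ((V × Fin t) ⊕ (V × Fin t)) ((V × Fin t) ⊕ (V × Fin t)) ℝ) : Prop :=
  (∀ u v : V, (∑ i : Fin t, ∑ j : Fin t, R (Sum.inl (u, i)) (Sum.inl (v, j))) = 1) ∧
  (∀ u v : V, (∑ i : Fin t, ∑ j : Fin t, R (Sum.inr (u, i)) (Sum.inr (v, j))) = 1) ∧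
  (∀ u v : V, (∑ i : Fin t, ∑ j : Fin t, R (Sum.inl (u, i)) (Sum.inr (v, j))) = 1)

/-- Feasibility of `t` in the program defining `χ̃_qa(G)`. -/
def chiqaFeas {V : Type} [Fintype V] (G : SimpleGraph V) [DecidableRel G.Adj] (t : ℕ) : Prop :=
  ∃ R : Matrix ((V × Fin t) ⊕ (V × Fin t)) ((V × Fin t) ⊕ (V × Fin t)) ℝ, R.IsSymm ∧
    R ∈ closure {S : Matrix ((V × Fin t) ⊕ (V × Fin t)) ((V × Fin t) ⊕ (V × Fin t)) ℝ |
      IsCSPlus S} ∧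
    InBt t R ∧ calL G t (piMap t R) = 0

/-- The parameter `χ̃_qa(G)`. -/
noncomputable def chiqaTilde {V : Type} [Fintype V] (G : SimpleGraph V)
    [DecidableRel G.Adj] : ℕ :=
  sInf {t : ℕ | chiqaFeas G t}

/-- The block matrix `R = [[A, A], [A, A]]`. -/
def blockRep {V : Type} (t : ℕ) (A : Matrix (V × Fin t) (V × Fin t) ℝ) :
    Matrix ((V × Fin t) ⊕ (V × Fin t)) ((V × Fin t) ⊕ (V × Fin t)) ℝ :=
  Matrix.of fun x y => A (Sum.elim id id x) (Sum.elim id id y)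

lemma IsCSPlus.submatrix {ι κ : Type} [Fintype ι] [Fintype κ] {A : Matrix ι ι ℝ}
    (hA : IsCSPlus A) (f : κ → ι) : IsCSPlus (A.submatrix f f) := by
  obtain ⟨d, hd, X, hX, hAX⟩ := hA
  exact ⟨d, hd, fun k => X (f k), fun k => hX (f k), fun i j => hAX (f i) (f j)⟩

lemma submatrix_mem_closure_isCSPlus {ι κ : Type} [Fintype ι] [Fintype κ] {A : Matrix ι ι ℝ}
    (hA : A ∈ closure {B : Matrix ι ι ℝ | IsCSPlus B}) (f : κ → ι) :
    A.submatrix f f ∈ closure {B : Matrix κ κ ℝ | IsCSPlus B} :=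
  map_mem_closure (f := fun B : Matrix ι ι ℝ => B.submatrix f f)
    (continuous_id.matrix_submatrix f f) hA fun _ hB => hB.submatrix f

lemma blockRep_mem_closure_isCSPlus {V : Type} [Fintype V] {t : ℕ}
    {A : Matrix (V × Fin t) (V × Fin t) ℝ}
    (hA : A ∈ closure {B : Matrix (V × Fin t) (V × Fin t) ℝ | IsCSPlus B}) :
    blockRep t A ∈ closure {S : Matrix ((V × Fin t) ⊕ (V × Fin t))
      ((V × Fin t) ⊕ (V × Fin t)) ℝ | IsCSPlus S} :=
  submatrix_mem_closure_isCSPlus hA (Sum.elim id id)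

lemma chiqFeas.chiqaFeas {V : Type} [Fintype V] {G : SimpleGraph V} [DecidableRel G.Adj] {t : ℕ}
    (h : chiqFeas G t) : chiqaFeas G t := by
  obtain ⟨A, hsymm, hA, hsum, hL⟩ := h
  exact ⟨blockRep t A, hsymm.submatrix (Sum.elim id id), blockRep_mem_closure_isCSPlus hA,
    ⟨hsum, hsum, hsum⟩, hL⟩

/-- The rank-one 0/1 matrix of a proper `t`-coloring is feasible for `χ̃_q`. -/
lemma chiqFeas_of_coloring {V : Type} [Fintype V] {G : SimpleGraph V} [DecidableRel G.Adj] {t : ℕ}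
    (c : G.Coloring (Fin t)) : chiqFeas G t := by
  let x : V × Fin t → ℝ := fun p => if p.2 = c p.1 then 1 else 0
  refine ⟨Matrix.of fun p q => x p * x q, ?_, subset_closure ?_, ?_, ?_⟩
  · ext p q
    simp [mul_comm]
  · refine ⟨1, le_rfl, fun p => Matrix.diagonal fun _ => x p, fun p => ?_, fun p q => ?_⟩
    · refine Matrix.PosSemidef.diagonal fun _ => ?_
      simp only [x, Pi.zero_apply]
      split_ifs <;> norm_num
    · simp
  · intro u v
    simp [x]
  · have hdiag : ∀ u (i j : Fin t), (if i ≠ j then x (u, i) * x (u, j) else 0) = 0 := by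
      intro u i j
      simp only [x]
      split_ifs <;> simp_all
    have hadj : ∀ u v, (if G.Adj u v then ∑ i, x (u, i) * x (v, i) else 0) = 0 := by
      intro u v
      split_ifs with huv
      · simpa [x] using (c.valid huv).symm
      · rfl
    simp only [LG, Matrix.of_apply, hdiag, hadj]
    simp

lemma exists_chiqFeas {V : Type} [Fintype V] (G : SimpleGraph V) [DecidableRel G.Adj] :
    ∃ t, chiqFeas G t :=
  ⟨Fintype.card V, chiqFeas_of_coloring <| SimpleGraph.Coloring.mk (Fintype.equivFin V)
    fun huv h => huv.ne ((Fintype.equivFin V).injective h)⟩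

/-- `χ̃_qa(G) ≤ χ̃_q(G)`; in particular, if `A ∈ cl(CS+^{nt})` lies in `A^t` and satisfies
`L_{G,t}(A) = 0`, then `R = [[A,A],[A,A]]` lies in `cl(CS+^{2nt}) ∩ B^t` and
`𝓛_{G,t}(π(R)) = 0`. -/
theorem stmt15 {V : Type} [Fintype V] (G : SimpleGraph V) [DecidableRel G.Adj]
    (hV : 1 ≤ Fintype.card V) :
    chiqaTilde G ≤ chiqTilde G ∧
    ∀ (t : ℕ) (A : Matrix (V × Fin t) (V × Fin t) ℝ),
      A ∈ closure {B : Matrix (V × Fin t) (V × Fin t) ℝ | IsCSPlus B} →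
      (∀ u v : V, (∑ i : Fin t, ∑ j : Fin t, A (u, i) (v, j)) = 1) →
      LG G t A = 0 →
      blockRep t A ∈ closure {S : Matrix ((V × Fin t) ⊕ (V × Fin t))
          ((V × Fin t) ⊕ (V × Fin t)) ℝ | IsCSPlus S} ∧
        InBt t (blockRep t A) ∧ calL G t (piMap t (blockRep t A)) = 0 := by
  refine ⟨?_, fun t A hA hsum hL =>
    ⟨blockRep_mem_closure_isCSPlus hA, ⟨hsum, hsum, hsum⟩, hL⟩⟩
  have hmin : chiqFeas G (chiqTilde G) := Nat.sInf_mem (s := {t | chiqFeas G t}) (exists_chiqFeas G)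
  exact Nat.sInf_le hmin.chiqaFeas
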